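/- arXiv:cs/0102008 — 5 statements merged into one kernel-verified Lean document; each statement's English description precedes it below -/
import Mathlib

section
/- Let n ≥ 2 be an integer and let R be a real with 1/n < R ≤ n. Then for every ℓ = 1, 2, …, n−1, one has d_{ℓ+1} = d'_ℓ. -/
/-- Expected number of objects the adversary `A` wins when `A` bids the multiset `BA`
in fixed positions and `D` bids the multiset `BD` by a uniformly random permutation. -/
noncomputable def W (n : ℕ) (BA BD : Multiset ℝ) : ℝ :=
  (1 / (n : ℝ)) * (BA.map (fun a =>
    ((BD.filter (fun b => b < a)).card : ℝ) +
    (1 / 2) * ((BD.filter (fun b => b = a)).card : ℝ))).sum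

/-- `⌊x⌋_y`: the largest integral multiple of `y` strictly less than `x`. -/
noncomputable def lfl (x y : ℝ) : ℝ := y * ((⌈x / y⌉ : ℝ) - 1)

/-- `R_ℓ := ⌊R⌋_{2/(ℓ(ℓ+1))}`. -/
noncomputable def Rl (R : ℝ) (ℓ : ℕ) : ℝ := lfl R (2 / ((ℓ : ℝ) * ((ℓ : ℝ) + 1)))

/-- `f(ℓ) := n − ℓ + ℓ(ℓ+1)·R_ℓ/(2n)`. -/
noncomputable def fA (n : ℕ) (R : ℝ) (ℓ : ℕ) : ℝ :=
  (n : ℝ) - (ℓ : ℝ) + (ℓ : ℝ) * ((ℓ : ℝ) + 1) * Rl R ℓ / (2 * (n : ℝ))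

/-- `ℓ₁`: the largest integer strictly less than `2n − 2/R + 1`. -/
noncomputable def ell1 (n : ℕ) (R : ℝ) : ℕ := (⌈2 * (n : ℝ) - 2 / R + 1⌉ - 1).toNat

/-- `ℓ₂ := min(n, ⌊n/R⌋)`. -/
noncomputable def ell2 (n : ℕ) (R : ℝ) : ℕ := min n (⌊(n : ℝ) / R⌋).toNat

/-- The optimal bid multiset `Ψ` of the disadvantaged bidder. -/
noncomputable def Psi (n : ℕ) (β R : ℝ) : Multiset ℝ :=
  if R ≤ 2 / ((n : ℝ) + 1) then
    Multiset.replicate (ell1 n R) 0 +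
      Multiset.replicate (n - ell1 n R) (β / ((n : ℝ) - (ell1 n R : ℝ)))
  else
    (Multiset.range (ell2 n R)).map
      (fun i => 2 * ((i : ℝ) + 1) * β / ((ell2 n R : ℝ) * ((ell2 n R : ℝ) + 1)))
      + Multiset.replicate (n - ell2 n R) 0

/-- `equilibrium(n,R)`. -/
noncomputable def equilibrium (n : ℕ) (R : ℝ) : ℝ :=
  if R ≤ 2 / ((n : ℝ) + 1) then (ell1 n R : ℝ) / (n : ℝ) else fA n R (ell2 n R)

/-- `k_ℓ := ⌊R_ℓ⌋`. -/
noncomputable def kk (R : ℝ) (ℓ : ℕ) : ℤ := ⌊Rl R ℓ⌋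

/-- `d_ℓ := ⌊(R_ℓ − k_ℓ)·ℓ/2⌋`. -/
noncomputable def dd (R : ℝ) (ℓ : ℕ) : ℤ := ⌊(Rl R ℓ - (kk R ℓ : ℝ)) * (ℓ : ℝ) / 2⌋

/-- `d'_ℓ := ⌊(R_ℓ − k_ℓ)·(ℓ+1)/2⌋`. -/
noncomputable def dd' (R : ℝ) (ℓ : ℕ) : ℤ := ⌊(Rl R ℓ - (kk R ℓ : ℝ)) * ((ℓ : ℝ) + 1) / 2⌋

/-- A multiple of `2/(ℓ(ℓ+1))` is at most `R_ℓ` exactly when it is less than `R`. -/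
theorem le_Rl_iff (R : ℝ) {ℓ : ℕ} (hℓ : 1 ≤ ℓ) {z : ℝ} (c : ℤ)
    (hz : z * ((ℓ : ℝ) * ((ℓ : ℝ) + 1)) = 2 * (c : ℝ)) : z ≤ Rl R ℓ ↔ z < R := by
  have hℓ' : (0 : ℝ) < ℓ := by exact_mod_cast hℓ
  have hy : (0 : ℝ) < 2 / ((ℓ : ℝ) * ((ℓ : ℝ) + 1)) := by positivity
  have hzc : z = (2 / ((ℓ : ℝ) * ((ℓ : ℝ) + 1))) * (c : ℝ) := by
    field_simp
    linarith
  have hcast : ((⌈R / (2 / ((ℓ : ℝ) * ((ℓ : ℝ) + 1)))⌉ : ℤ) : ℝ) - 1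
      = ((⌈R / (2 / ((ℓ : ℝ) * ((ℓ : ℝ) + 1)))⌉ - 1 : ℤ) : ℝ) := by push_cast; rfl
  rw [hzc, Rl, lfl, mul_le_mul_iff_right₀ hy, hcast, Int.cast_le, Int.le_sub_one_iff,
    Int.lt_ceil, lt_div_iff₀ hy, mul_comm]

theorem kk_eq (R : ℝ) {ℓ : ℕ} (hℓ : 1 ≤ ℓ) : kk R ℓ = ⌈R⌉ - 1 := by
  refine eq_of_forall_le_iff fun c => ?_
  obtain ⟨t, ht⟩ := Nat.even_mul_succ_self ℓ
  have ht' : (ℓ : ℝ) * ((ℓ : ℝ) + 1) = t + t := by exact_mod_cast ht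
  rw [kk, Int.le_floor, le_Rl_iff R hℓ (c * t) (by rw [ht']; push_cast; ring),
    Int.le_sub_one_iff, Int.lt_ceil]

/-- When `m` divides `ℓ(ℓ+1)`, the integers `a ≤ ⌊(R_ℓ - k_ℓ)·m/2⌋` are those with
`⌈R⌉ - 1 + 2a/m < R`, a condition that does not involve `ℓ`. -/
theorem le_floor_Rl_iff (R : ℝ) {ℓ : ℕ} (hℓ : 1 ≤ ℓ) {m p : ℕ} (hm : 1 ≤ m)
    (hmp : ℓ * (ℓ + 1) = m * p) (a : ℤ) :
    a ≤ ⌊(Rl R ℓ - (kk R ℓ : ℝ)) * (m : ℝ) / 2⌋ ↔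
      ((⌈R⌉ - 1 : ℤ) : ℝ) + 2 * (a : ℝ) / m < R := by
  have hm' : (0 : ℝ) < m := by exact_mod_cast hm
  have hmp' : (ℓ : ℝ) * ((ℓ : ℝ) + 1) = m * p := by exact_mod_cast hmp
  obtain ⟨t, ht⟩ := Nat.even_mul_succ_self ℓ
  have ht' : (ℓ : ℝ) * ((ℓ : ℝ) + 1) = t + t := by exact_mod_cast ht
  rw [kk_eq R hℓ, Int.le_floor, ← le_Rl_iff R hℓ ((⌈R⌉ - 1) * t + a * p), ← le_sub_iff_add_le',
    div_le_iff₀ hm', le_div_iff₀ two_pos, mul_comm (a : ℝ)]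
  rw [add_mul, ht', div_mul_eq_mul_div, ← ht', hmp']
  have h2 : (2 * (a : ℝ) * (m * p)) / m = 2 * (a * p) := by field_simp
  rw [h2, ← hmp', ht']
  push_cast
  ring

/-- for `1/n < R ≤ n` and `1 ≤ ℓ ≤ n−1`, `d_{ℓ+1} = d'_ℓ`. -/
theorem statement7 (n : ℕ) (hn : 2 ≤ n) (R : ℝ)
    (hR1 : 1 / (n : ℝ) < R) (hR2 : R ≤ (n : ℝ)) :
    ∀ ℓ : ℕ, 1 ≤ ℓ → ℓ ≤ n - 1 → dd R (ℓ + 1) = dd' R ℓ := by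
  intro ℓ hℓ _
  refine eq_of_forall_le_iff fun a => ?_
  have h := le_floor_Rl_iff R (Nat.le_add_left 1 ℓ) (m := ℓ + 1) (Nat.le_add_left 1 ℓ) rfl a
  have h' := le_floor_Rl_iff R hℓ (m := ℓ + 1) (Nat.le_add_left 1 ℓ) (mul_comm _ _) a
  rw [dd, h, dd', ← h', Nat.cast_succ]
end

section
/- Let n ≥ 1 be an integer and let R be a real with 1 < R ≤ n, and set ℓ := ⌊n/R⌋ (so 1 ≤ ℓ ≤ n−1 and Rℓ ≤ n < R(ℓ+1)). Then f(ℓ) ≤ f(ℓ+1). -/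
theorem fA_eq_ceil (n : ℕ) (R : ℝ) {ℓ : ℕ} (hℓ : 0 < ℓ) :
    fA n R ℓ = n - ℓ + ((⌈(ℓ : ℝ) * (ℓ + 1) * R / 2⌉ : ℝ) - 1) / n := by
  have hpos : (0 : ℝ) < ℓ := Nat.cast_pos.mpr hℓ
  have harg : R / (2 / ((ℓ : ℝ) * (ℓ + 1))) = (ℓ : ℝ) * (ℓ + 1) * R / 2 := by
    field_simp
  unfold fA Rl lfl
  rw [harg]
  generalize (⌈(ℓ : ℝ) * (ℓ + 1) * R / 2⌉ : ℝ) = c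
  congr 1
  field_simp

/-- `f(ℓ) ≤ f(ℓ+1)` as soon as `n ≤ (ℓ+1)R`. -/
theorem fA_le_fA_succ {n ℓ : ℕ} {R : ℝ} (hn : 0 < n) (hℓ : 0 < ℓ)
    (h : (n : ℝ) ≤ (ℓ + 1) * R) : fA n R ℓ ≤ fA n R (ℓ + 1) := by
  have hn' : (0 : ℝ) < n := Nat.cast_pos.mpr hn
  rw [fA_eq_ceil n R hℓ, fA_eq_ceil n R ℓ.succ_pos]
  push_cast
  have hceil : ⌈(ℓ : ℝ) * (ℓ + 1) * R / 2⌉ + (n : ℤ)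
      ≤ ⌈((ℓ : ℝ) + 1) * (ℓ + 1 + 1) * R / 2⌉ := by
    rw [← Int.ceil_add_natCast]
    exact Int.ceil_le_ceil (by linarith)
  have hcast : (⌈(ℓ : ℝ) * (ℓ + 1) * R / 2⌉ : ℝ) + n
      ≤ ⌈((ℓ : ℝ) + 1) * (ℓ + 1 + 1) * R / 2⌉ := by
    exact_mod_cast hceil
  have hdiv := div_le_div_of_nonneg_right (sub_le_sub_right hcast 1) hn'.le
  rw [add_sub_right_comm, add_div, div_self hn'.ne'] at hdiv
  linarith

/-- for `1 < R ≤ n` and `ℓ := ⌊n/R⌋`, one has `f(ℓ) ≤ f(ℓ+1)`. -/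
theorem statement13 (n : ℕ) (hn : 1 ≤ n) (R : ℝ)
    (hR1 : 1 < R) (hR2 : R ≤ (n : ℝ)) :
    fA n R (⌊(n : ℝ) / R⌋).toNat ≤ fA n R ((⌊(n : ℝ) / R⌋).toNat + 1) := by
  have hR : 0 < R := one_pos.trans hR1
  rw [Int.floor_toNat]
  refine fA_le_fA_succ hn (Nat.floor_pos.mpr ((one_le_div hR).mpr hR2)) ?_
  exact ((div_lt_iff₀ hR).mp (Nat.lt_floor_add_one _)).le
end

section
/- Fix a real R ≥ 1. Then the effective winning ratio of the adversary satisfies lim_{n→∞} E_A(n,R) = (2R−1)(R+1)/(2R²), where the limit is over integers n → ∞ (so that 2/(n+1) < R ≤ n holds for all sufficiently large n and equilibrium(n,R) is defined). -/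
open Filter Topology

theorem lfl_lt {x y : ℝ} (hy : 0 < y) : lfl x y < x := by
  have h : (⌈x / y⌉ : ℝ) - 1 < x / y := by linarith [Int.ceil_lt_add_one (x / y)]
  calc lfl x y < y * (x / y) := mul_lt_mul_of_pos_left h hy
    _ = x := mul_div_cancel₀ x hy.ne'

theorem sub_le_lfl {x y : ℝ} (hy : 0 < y) : x - y ≤ lfl x y := by
  calc x - y = y * (x / y - 1) := by field_simp
    _ ≤ lfl x y := mul_le_mul_of_nonneg_left (by linarith [Int.le_ceil (x / y)]) hy.le

theorem tendsto_lfl (x : ℝ) : Tendsto (lfl x) (𝓝[>] 0) (𝓝 x) := by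
  have hsub : Tendsto (fun y : ℝ => x - y) (𝓝[>] 0) (𝓝 x) := by
    have h : Tendsto (fun y : ℝ => x - y) (𝓝 0) (𝓝 (x - 0)) := tendsto_const_nhds.sub tendsto_id
    rw [sub_zero] at h
    exact h.mono_left nhdsWithin_le_nhds
  refine tendsto_of_tendsto_of_tendsto_of_le_of_le' hsub tendsto_const_nhds ?_ ?_
  · filter_upwards [self_mem_nhdsWithin] with y hy using sub_le_lfl hy
  · filter_upwards [self_mem_nhdsWithin] with y hy using (lfl_lt hy).le

theorem tendsto_Rl (R : ℝ) : Tendsto (Rl R) atTop (𝓝 R) := by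
  refine (tendsto_lfl R).comp (tendsto_nhdsWithin_iff.2 ⟨?_, ?_⟩)
  · have h : Tendsto (fun ℓ : ℕ => (ℓ : ℝ)) atTop atTop := tendsto_natCast_atTop_atTop
    exact (h.atTop_mul_atTop₀ (tendsto_atTop_add_const_right _ 1 h)).const_div_atTop 2
  · filter_upwards [eventually_gt_atTop 0] with ℓ hℓ
    have : (0 : ℝ) < ℓ := Nat.cast_pos.2 hℓ
    exact Set.mem_Ioi.2 (by positivity)

theorem ell2_eq_floor (n : ℕ) {R : ℝ} (hR : 1 ≤ R) : ell2 n R = ⌊(n : ℝ) / R⌋₊ := by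
  rw [ell2, Int.floor_toNat, min_eq_right]
  exact Nat.floor_le_of_le (div_le_self n.cast_nonneg hR)

theorem tendsto_ell2_atTop {R : ℝ} (hR : 1 ≤ R) :
    Tendsto (fun n : ℕ => ell2 n R) atTop atTop := by
  simp only [ell2_eq_floor _ hR]
  exact tendsto_nat_floor_atTop.comp
    (tendsto_natCast_atTop_atTop.atTop_div_const (zero_lt_one.trans_le hR))

theorem tendsto_ell2_div {R : ℝ} (hR : 1 ≤ R) :
    Tendsto (fun n : ℕ => (ell2 n R : ℝ) / n) atTop (𝓝 R⁻¹) := by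
  have hR0 : 0 ≤ R⁻¹ := inv_nonneg.2 (zero_le_one.trans hR)
  refine ((tendsto_nat_floor_mul_div_atTop hR0).comp
    (tendsto_natCast_atTop_atTop (R := ℝ))).congr fun n => ?_
  simp only [Function.comp_apply, ell2_eq_floor _ hR, div_eq_inv_mul]

theorem tendsto_fA_ell2_div {R : ℝ} (hR : 1 ≤ R) :
    Tendsto (fun n : ℕ => fA n R (ell2 n R) / n) atTop (𝓝 (1 - (2 * R)⁻¹)) := by
  have hR0 : R ≠ 0 := (zero_lt_one.trans_le hR).ne'
  have hu := tendsto_ell2_div hR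
  have hRl := (tendsto_Rl R).comp (tendsto_ell2_atTop hR)
  have hinv : Tendsto (fun n : ℕ => (n : ℝ)⁻¹) atTop (𝓝 0) := tendsto_inv_atTop_nhds_zero_nat
  have h := (hu.const_sub 1).add (((hu.mul (hu.add hinv)).mul hRl).div_const 2)
  have hlim : 1 - R⁻¹ + R⁻¹ * (R⁻¹ + 0) * R / 2 = 1 - (2 * R)⁻¹ := by
    field_simp
    ring
  rw [hlim] at h
  refine h.congr' ?_
  filter_upwards [eventually_ne_atTop 0] with n hn
  have : (n : ℝ) ≠ 0 := Nat.cast_ne_zero.2 hn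
  simp only [Function.comp_apply, fA]
  field_simp

/-- for `R ≥ 1`, the adversary's effective winning ratio
`E_A(n,R) = equilibrium(n,R)/(nR/(R+1))`, with `equilibrium(n,R) = f(ℓ₂)`,
tends to `(2R−1)(R+1)/(2R²)` as `n → ∞`. -/
theorem statement14 (R : ℝ) (hR : 1 ≤ R) :
    Filter.Tendsto (fun n : ℕ => fA n R (ell2 n R) / ((n : ℝ) * R / (R + 1)))
      Filter.atTop (nhds ((2 * R - 1) * (R + 1) / (2 * R ^ 2))) := by
  have hR0 : R ≠ 0 := (zero_lt_one.trans_le hR).ne'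
  have h := (tendsto_fA_ell2_div hR).div_const (R / (R + 1))
  have hlim : (1 - (2 * R)⁻¹) / (R / (R + 1)) = (2 * R - 1) * (R + 1) / (2 * R ^ 2) := by
    field_simp
  rw [hlim] at h
  refine h.congr fun n => ?_
  rw [div_div, mul_div_assoc]
end

section
/- Fix a real R with 0 < R ≤ 1. Then the effective winning ratio of the adversary satisfies lim_{n→∞} E_A(n,R) = (R+1)/2, where the limit is over integers n → ∞ (so that 2/(n+1) < R ≤ n holds for all sufficiently large n and equilibrium(n,R) is defined). -/
theorem ell2_eq_self {n : ℕ} {R : ℝ} (hR0 : 0 < R) (hR1 : R ≤ 1) : ell2 n R = n := by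
  have h : (n : ℤ) ≤ ⌊(n : ℝ) / R⌋ := by
    rw [Int.le_floor, Int.cast_natCast, le_div_iff₀ hR0]
    exact mul_le_of_le_one_right n.cast_nonneg hR1
  rw [ell2]
  omega

theorem fA_self {n : ℕ} (hn : 0 < n) (R : ℝ) :
    fA n R n = ((⌈R * ((n : ℝ) * (n + 1)) / 2⌉ : ℝ) - 1) / n := by
  have hn' : (0 : ℝ) < n := by exact_mod_cast hn
  rw [fA, Rl, lfl, div_div_eq_mul_div]
  field_simp
  ring

/-- for `0 < R ≤ 1`, the adversary's effective winning ratio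
`E_A(n,R) = equilibrium(n,R)/(nR/(R+1))`, with `equilibrium(n,R) = f(ℓ₂)`,
tends to `(R+1)/2` as `n → ∞`. -/
theorem statement16 (R : ℝ) (hR0 : 0 < R) (hR1 : R ≤ 1) :
    Filter.Tendsto (fun n : ℕ => fA n R (ell2 n R) / ((n : ℝ) * R / (R + 1)))
      Filter.atTop (nhds ((R + 1) / 2)) := by
  have h1 : Filter.Tendsto (fun n : ℕ => 1 / (n : ℝ)) Filter.atTop (nhds 0) :=
    tendsto_one_div_atTop_nhds_zero_nat
  have upper : Filter.Tendsto (fun n : ℕ => (R + 1) / 2 * (1 + 1 / (n : ℝ))) Filter.atTop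
      (nhds ((R + 1) / 2)) := by
    simpa using (h1.const_add 1).const_mul ((R + 1) / 2)
  have lower : Filter.Tendsto
      (fun n : ℕ => (R + 1) / 2 * (1 + 1 / (n : ℝ)) - (R + 1) / R * (1 / (n : ℝ)) ^ 2)
      Filter.atTop (nhds ((R + 1) / 2)) := by
    simpa using upper.sub ((h1.pow 2).const_mul ((R + 1) / R))
  have ratio : ∀ n : ℕ, 0 < n → fA n R (ell2 n R) / ((n : ℝ) * R / (R + 1)) =
      (R + 1) / (R * (n : ℝ) ^ 2) * ((⌈R * ((n : ℝ) * (n + 1)) / 2⌉ : ℝ) - 1) := by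
    intro n hn
    have hn' : (0 : ℝ) < n := by exact_mod_cast hn
    rw [ell2_eq_self hR0 hR1, fA_self hn]
    field_simp
  refine tendsto_of_tendsto_of_tendsto_of_le_of_le' lower upper ?_ ?_ <;>
    filter_upwards [Filter.eventually_gt_atTop 0] with n hn <;>
    have hn' : (0 : ℝ) < n := by exact_mod_cast hn
  · rw [ratio n hn]
    calc _ = (R + 1) / (R * (n : ℝ) ^ 2) * (R * ((n : ℝ) * (n + 1)) / 2 - 1) := by
          field_simp
      _ ≤ _ := by
          gcongr
          exact Int.le_ceil _
  · rw [ratio n hn]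
    calc _ ≤ (R + 1) / (R * (n : ℝ) ^ 2) * (R * ((n : ℝ) * (n + 1)) / 2) := by
          gcongr
          linarith [Int.ceil_lt_add_one (R * ((n : ℝ) * (n + 1)) / 2)]
      _ = _ := by field_simp
end

section
/- Let n ≥ 1 be an integer and β > 0, R be reals with R > n. Then for every bid multiset B_D of n nonnegative reals with total at most β, there exists a bid multiset B_A of n nonnegative reals with total at most βR such that W(B_A, B_D) = n; that is, the adversary A can win every object in expectation. -/
/-- If every bid of `D` is strictly below the constant bid `c`, then bidding `c` on all
objects wins them all. -/
theorem W_replicate_of_forall_lt {n : ℕ} (hn : n ≠ 0) {c : ℝ} {BD : Multiset ℝ}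
    (hcard : BD.card = n) (hlt : ∀ b ∈ BD, b < c) :
    W n (Multiset.replicate n c) BD = n := by
  have hbelow : BD.filter (fun b => b < c) = BD := Multiset.filter_eq_self.2 hlt
  have htie : BD.filter (fun b => b = c) = 0 :=
    Multiset.filter_eq_nil.2 fun b hb => (hlt b hb).ne
  have hn' : (n : ℝ) ≠ 0 := Nat.cast_ne_zero.2 hn
  simp only [W, Multiset.map_replicate, Multiset.sum_replicate, hbelow, htie, hcard,
    Multiset.card_zero, Nat.cast_zero, nsmul_eq_mul]
  field_simp
  ring

/-- if `R > n`, then against any bid multiset of the disadvantaged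
bidder with total at most `β`, the adversary can win every object in expectation. -/
theorem statement18 (n : ℕ) (hn : 1 ≤ n) (β R : ℝ) (hβ : 0 < β)
    (hR : (n : ℝ) < R)
    (BD : Multiset ℝ) (hcard : BD.card = n) (hpos : ∀ b ∈ BD, 0 ≤ b)
    (hsum : BD.sum ≤ β) :
    ∃ BA : Multiset ℝ, BA.card = n ∧ (∀ a ∈ BA, 0 ≤ a) ∧ BA.sum ≤ β * R ∧
      W n BA BD = (n : ℝ) := by
  have hn0 : (0 : ℝ) < n := by exact_mod_cast hn
  have hc : β < β * R / n := by
    rw [lt_div_iff₀ hn0]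
    exact mul_lt_mul_of_pos_left hR hβ
  refine ⟨Multiset.replicate n (β * R / n), Multiset.card_replicate _ _, ?_, ?_, ?_⟩
  · intro a ha
    rw [Multiset.eq_of_mem_replicate ha]
    exact (hβ.trans hc).le
  · rw [Multiset.sum_replicate, nsmul_eq_mul, mul_div_cancel₀ _ hn0.ne']
  · exact W_replicate_of_forall_lt (by omega) hcard fun b hb =>
      ((Multiset.single_le_sum hpos b hb).trans hsum).trans_lt hc
end
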